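/- If V is a commutative semigroup variety with V ≠ COM, then V = K ∨ N, where K is a variety generated by a monoid and N is a nil-variety. -/

import Mathlib

open FirstOrder

/-! ### Words, identities, and commutative semigroup varieties -/

/-- Semigroup words over the countable alphabet `ℕ`. -/
abbrev SGWord : Type := FreeSemigroup ℕ

/-- A semigroup identity `u = v` is a pair of words. -/
abbrev SGId : Type := SGWord × SGWord

/-- The one-letter word consisting of the letter `n`. -/
def ltr (n : ℕ) : SGWord := FreeSemigroup.of n

/-- `wpow w n` is the word `w^n` (for `n ≥ 1`; by convention `wpow w 0 = w`). -/
def wpow (w : SGWord) : ℕ → SGWord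
  | 0 => w
  | 1 => w
  | n + 2 => wpow w (n + 1) * w

/-- The letter `n` occurs in the word `w`. -/
def OccursIn (n : ℕ) (w : SGWord) : Prop := n = w.head ∨ n ∈ w.tail

/-- A semigroup `S` satisfies the identity `i.1 = i.2` if all evaluations of the two
words in `S` coincide. -/
def SGSatisfies (S : Type) [Semigroup S] (i : SGId) : Prop :=
  ∀ f : ℕ → S, FreeSemigroup.lift f i.1 = FreeSemigroup.lift f i.2

/-- A bundled (nonempty) commutative semigroup. -/
structure ComSG where
  carrier : Type
  [str : CommSemigroup carrier]
  [instNonempty : Nonempty carrier]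

attribute [instance] ComSG.str ComSG.instNonempty

/-- The class of commutative semigroups satisfying every identity in `E`. -/
def modelsOf (E : Set SGId) : Set ComSG := {S | ∀ i ∈ E, SGSatisfies S.carrier i}

/-- The set of identities holding in every member of the class `K`. -/
def theoryOfClass (K : Set ComSG) : Set SGId := {i | ∀ S ∈ K, SGSatisfies S.carrier i}

theorem subset_theoryOfClass_modelsOf (E : Set SGId) : E ⊆ theoryOfClass (modelsOf E) :=
  fun i hi S hS => hS i hi

theorem theoryOfClass_antitone {K K' : Set ComSG} (h : K ⊆ K') :
    theoryOfClass K' ⊆ theoryOfClass K := fun _ hi S hS => hi S (h hS)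

theorem modelsOf_antitone {E E' : Set SGId} (h : E ⊆ E') : modelsOf E' ⊆ modelsOf E :=
  fun _ hS i hi => hS i (h hi)

/-- A variety of commutative semigroups, identified with its (equationally closed)
equational theory.  Varieties are ordered by inclusion of the corresponding classes
of semigroups, i.e. by *reverse* inclusion of theories. -/
structure ComVariety where
  theory : Set SGId
  closed : theoryOfClass (modelsOf theory) = theory

theorem ComVariety.ext' {V W : ComVariety} (h : V.theory = W.theory) : V = W := by
  cases V; cases W; cases h; rfl

instance : PartialOrder ComVariety where
  le V W := W.theory ⊆ V.theory
  le_refl V := subset_rfl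
  le_trans U V W h1 h2 := fun i hi => h1 (h2 hi)
  le_antisymm V W h1 h2 := ComVariety.ext' (subset_antisymm h2 h1)

instance : SupSet ComVariety where
  sSup s :=
    { theory := ⋂ V ∈ s, V.theory
      closed := by
        apply subset_antisymm
        · intro i hi
          refine Set.mem_iInter₂.2 fun V hV => ?_
          have h1 : (⋂ V ∈ s, ComVariety.theory V) ⊆ V.theory := Set.biInter_subset_of_mem hV
          have h2 := theoryOfClass_antitone (modelsOf_antitone h1)
          rw [V.closed] at h2
          exact h2 hi
        · exact subset_theoryOfClass_modelsOf _ }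

/-- The lattice **Com** of all commutative semigroup varieties. -/
instance : CompleteLattice ComVariety :=
  completeLatticeOfSup ComVariety fun s => by
    constructor
    · intro V hV i hi
      exact Set.mem_iInter₂.1 hi V hV
    · intro W hW i hi
      exact Set.mem_iInter₂.2 fun V hV => hW hV hi

/-- The variety of commutative semigroups given by the identity system `E`. -/
def comVar (E : Set SGId) : ComVariety where
  theory := theoryOfClass (modelsOf E)
  closed := by
    apply subset_antisymm
    · exact theoryOfClass_antitone fun S hS i hi => hi S hS
    · exact subset_theoryOfClass_modelsOf _

/-! ### The first-order language of lattices and definability -/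

/-- The first-order language of lattices: two binary function symbols (`true` for the
join `∨` and `false` for the meet `∧`) and nothing else. -/
def latticeLang : Language where
  Functions := fun n => match n with | 2 => Bool | _ => Empty
  Relations := fun _ => Empty

instance latticeLangStructure (L : Type*) [Lattice L] : latticeLang.Structure L where
  funMap {n} f x :=
    match n, f with
    | 2, b => bif b then x 0 ⊔ x 1 else x 0 ⊓ x 1
    | 0, f => f.elim
    | 1, f => f.elim
    | (_ + 3), f => f.elim
  RelMap {n} r _ := r.elim

/-- A subset `A` of a lattice `L` is definable in `L` if there is a first-order formula
`φ(x)` with one free variable in the language of the lattice operations `∨` and `∧`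
such that for every `a ∈ L`, `φ(a)` holds in `L` if and only if `a ∈ A`. -/
def LatDefinable (L : Type*) [Lattice L] (A : Set L) : Prop :=
  ∃ φ : latticeLang.Formula (Fin 1), ∀ a : L, (φ.Realize fun _ => a) ↔ a ∈ A

/-! ### Named varieties -/

/-- The commutativity identity `xy = yx`. -/
def commId : SGId := (ltr 0 * ltr 1, ltr 1 * ltr 0)

/-- The pair of identities abbreviated by the symbolic identity `w = 0`, namely
`wx = w` and `xw = w`, where `x` is the letter `n` (assumed not to occur in `w`). -/
def zeroId (w : SGWord) (n : ℕ) : Set SGId := {(w * ltr n, w), (ltr n * w, w)}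

/-- `A n = var{xⁿy = y, xy = yx}`, the variety of Abelian groups of exponent dividing `n`. -/
def Avar (n : ℕ) : ComVariety := comVar {(wpow (ltr 0) n * ltr 1, ltr 1), commId}

/-- `SL = var{x² = x, xy = yx}`, the variety of semilattices. -/
def SLvar : ComVariety := comVar {(wpow (ltr 0) 2, ltr 0), commId}

/-- `ZM = var{xy = 0}` (within **Com**), the variety of null semigroups. -/
def ZMvar : ComVariety := comVar ({commId} ∪ zeroId (ltr 0 * ltr 1) 2)

/-- `T = var{x = y}`, the trivial variety. -/
def Tvar : ComVariety := comVar {(ltr 0, ltr 1)}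

/-- `COM`, the variety of all commutative semigroups. -/
def COMvar : ComVariety := comVar {commId}

/-- `C m = var{xᵐ = xᵐ⁺¹, xy = yx}` (the variety generated by the cyclic monoid
`⟨a ∣ aᵐ = aᵐ⁺¹⟩`), with the convention `C 0 = T`. -/
def Cvar : ℕ → ComVariety
  | 0 => Tvar
  | m + 1 => comVar {(wpow (ltr 0) (m + 1), wpow (ltr 0) (m + 2)), commId}

/-- `D m = var{xᵐ = 0, xy = yx}`. -/
def Dvar (m : ℕ) : ComVariety := comVar ({commId} ∪ zeroId (wpow (ltr 0) m) 1)

/-- The word `x₁x₂⋯x_k` (in the letters `0, 1, …, k-1`), for `k ≥ 1`. -/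
def chainWord : ℕ → SGWord
  | 0 => ltr 0
  | 1 => ltr 0
  | k + 2 => chainWord (k + 1) * ltr (k + 1)

/-- `N k = var{x² = x₁x₂⋯x_k = 0, xy = yx}`. -/
def Nvar (k : ℕ) : ComVariety :=
  comVar ({commId} ∪ zeroId (wpow (ltr 0) 2) 1 ∪ zeroId (chainWord k) k)

/-- `N_ω = var{x² = 0, xy = yx}`. -/
def Nomegavar : ComVariety := comVar ({commId} ∪ zeroId (wpow (ltr 0) 2) 1)

/-- `N₃ᶜ = var{xyz = 0, xy = yx}`. -/
def N3cvar : ComVariety := comVar ({commId} ∪ zeroId (ltr 0 * ltr 1 * ltr 2) 3)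

/-! ### Semantic notions -/

/-- A semigroup `S` belongs to the variety `V` if it satisfies every identity of `V`. -/
def VMem (S : Type) [Semigroup S] (V : ComVariety) : Prop :=
  ∀ i ∈ V.theory, SGSatisfies S i

/-- `spow a n` is the power `aⁿ` in a semigroup (for `n ≥ 1`; by convention `spow a 0 = a`). -/
def spow {S : Type} [Semigroup S] (a : S) : ℕ → S
  | 0 => a
  | 1 => a
  | n + 2 => spow a (n + 1) * a

/-- A semigroup is a group. -/
def IsGroupSG (S : Type) [Semigroup S] : Prop :=
  ∃ e : S, (∀ a, e * a = a ∧ a * e = a) ∧ ∀ a, ∃ b, a * b = e ∧ b * a = e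

/-- A semigroup is periodic: every element generates a finite cyclic subsemigroup. -/
def IsPeriodicSG (S : Type) [Semigroup S] : Prop :=
  ∀ a : S, ∃ i j : ℕ, 1 ≤ i ∧ i < j ∧ spow a i = spow a j

/-- A semigroup is a nil-semigroup: it has a zero element and every element has a
power equal to zero. -/
def IsNilSG (S : Type) [Semigroup S] : Prop :=
  ∃ z : S, (∀ a, z * a = z ∧ a * z = z) ∧ ∀ a, ∃ n, 1 ≤ n ∧ spow a n = z

/-- A variety all of whose members are groups. -/
def IsGroupVariety (V : ComVariety) : Prop := ∀ S ∈ modelsOf V.theory, IsGroupSG S.carrier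

/-- A variety all of whose members are periodic semigroups. -/
def IsPeriodicVariety (V : ComVariety) : Prop := ∀ S ∈ modelsOf V.theory, IsPeriodicSG S.carrier

/-- A nil-variety: a variety all of whose members are nil-semigroups. -/
def IsNilVariety (V : ComVariety) : Prop := ∀ S ∈ modelsOf V.theory, IsNilSG S.carrier

/-- A combinatorial variety: all groups in it are trivial. -/
def IsCombinatorial (V : ComVariety) : Prop :=
  ∀ S ∈ modelsOf V.theory, IsGroupSG S.carrier → ∀ a b : S.carrier, a = b

/-- `K` is the variety generated by the semigroup `M` (with explicit semigroup
structure `inst`): the smallest variety containing `M`. -/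
def GeneratedBy (M : Type) (inst : Semigroup M) (K : ComVariety) : Prop :=
  IsLeast {W : ComVariety | ∀ i ∈ W.theory, @SGSatisfies M inst i} K

/-- A neutral element of a lattice. -/
def IsNeutralElt {α : Type*} [Lattice α] (x : α) : Prop :=
  ∀ y z, (x ⊔ y) ⊓ (y ⊔ z) ⊓ (z ⊔ x) = (x ⊓ y) ⊔ (y ⊓ z) ⊔ (z ⊓ x)

/-- A chain variety: a variety whose lattice of subvarieties is a chain. -/
def IsChainVariety (V : ComVariety) : Prop :=
  ∀ W₁ W₂ : ComVariety, W₁ ≤ V → W₂ ≤ V → W₁ ≤ W₂ ∨ W₂ ≤ W₁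

/-- A variety is 0-reduced in **Com** if it is given within `COM` by 0-reduced
identities (identities of the form `w = 0`) only. -/
def IsZeroReduced (V : ComVariety) : Prop :=
  ∃ P : Set (SGWord × ℕ), (∀ p ∈ P, ¬ OccursIn p.2 p.1) ∧
    V = comVar (⋃ p ∈ P, zeroId p.1 p.2)

/-- `ZR V`: the least variety 0-reduced in **Com** that contains `V`. -/
def ZRv (V : ComVariety) : ComVariety := sInf {W : ComVariety | IsZeroReduced W ∧ V ≤ W}

/-! ### Powers and words in semigroups -/

section Words

variable {S T : Type} [Semigroup S] [Semigroup T]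

theorem coe_spow (a : S) {n : ℕ} (hn : 1 ≤ n) :
    ((spow a n : S) : WithOne S) = (a : WithOne S) ^ n := by
  induction n, hn using Nat.le_induction with
  | base => simp [spow]
  | succ n hn ih =>
    obtain ⟨m, rfl⟩ : ∃ m, n = m + 1 := ⟨n - 1, by omega⟩
    rw [pow_succ, ← ih, ← WithOne.coe_mul]
    rfl

theorem map_spow (g : S →ₙ* T) (a : S) (n : ℕ) : g (spow a n) = spow (g a) n := by
  rcases n with _ | n
  · rfl
  induction n with
  | zero => rfl
  | succ n ih =>
    change g (spow a (n + 1) * a) = spow (g a) (n + 1) * g a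
    rw [map_mul, ih]

/-- The list of letters of a word. -/
def letters (w : SGWord) : List ℕ := w.head :: w.tail

theorem letters_mul (u v : SGWord) : letters (u * v) = letters u ++ letters v := rfl

theorem coe_lift (f : ℕ → S) (w : SGWord) :
    ((FreeSemigroup.lift f w : S) : WithOne S) =
      ((letters w).map fun i => (f i : WithOne S)).prod := by
  induction w using FreeSemigroup.recOnMul with
  | ih1 i => rw [FreeSemigroup.lift_of]; simp [letters, FreeSemigroup.of]
  | ih2 u v hu hv =>
    rw [map_mul, WithOne.coe_mul, hu, hv, letters_mul, List.map_append, List.prod_append]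

theorem map_lift (g : S →ₙ* T) (f : ℕ → S) (w : SGWord) :
    g (FreeSemigroup.lift f w) = FreeSemigroup.lift (fun i => g (f i)) w := by
  induction w using FreeSemigroup.recOnMul with
  | ih1 i => simp
  | ih2 u v hu hv => simp only [map_mul, hu, hv]

theorem lift_eq_of_perm {S : Type} [CommSemigroup S] (f : ℕ → S) {u v : SGWord}
    (h : (letters u).Perm (letters v)) :
    FreeSemigroup.lift f u = FreeSemigroup.lift f v := by
  apply WithOne.coe_injective
  rw [coe_lift, coe_lift]
  exact (h.map _).prod_eq

theorem lift_mul_left_eq {S : Type} [CommSemigroup S] {e : S} (he : e * e = e) (f : ℕ → S)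
    (w : SGWord) :
    FreeSemigroup.lift (fun i => e * f i) w = e * FreeSemigroup.lift f w := by
  induction w using FreeSemigroup.recOnMul with
  | ih1 i => simp
  | ih2 u v hu hv => rw [map_mul, map_mul, hu, hv, mul_mul_mul_comm, he]

theorem lift_spow_weight (a : S) (i N : ℕ) (w : SGWord) :
    FreeSemigroup.lift (fun j => spow a (if j = i then N + 1 else 1)) w =
      spow a ((letters w).length + N * (letters w).count i) := by
  apply WithOne.coe_injective
  rw [coe_lift, coe_spow _ (by simp [letters]; omega)]
  induction letters w with
  | nil => simp
  | cons j l ih =>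
    rw [List.map_cons, List.prod_cons, ih, coe_spow _ (by split_ifs <;> omega), ← pow_add]
    congr 1
    by_cases h : j = i
    · subst h; simp; ring
    · simp [h]; ring

theorem spow_mul_self_of_eq {p d : ℕ} (hp : 1 ≤ p) (hd : 1 ≤ d) {a : S}
    (h : spow a p = spow a (p + d)) :
    spow a (p * d) * spow a (p * d) = spow a (p * d) := by
  have h' : (a : WithOne S) ^ (p + d) = (a : WithOne S) ^ p := by
    rw [← coe_spow a hp, ← coe_spow a (by omega), h]
  have key : ∀ j, (a : WithOne S) ^ (p + j * d) = (a : WithOne S) ^ p := by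
    intro j
    induction j with
    | zero => simp
    | succ j ih =>
      rw [show p + (j + 1) * d = (p + d) + j * d by ring, pow_add, h', ← pow_add, ih]
  obtain ⟨c, hc⟩ : ∃ c, p * d = p + c :=
    ⟨p * d - p, by have := Nat.mul_le_mul_left p hd; omega⟩
  apply WithOne.coe_injective
  rw [WithOne.coe_mul, coe_spow a (Nat.mul_pos hp hd), ← pow_add]
  calc (a : WithOne S) ^ (p * d + p * d) = a ^ (p + p * d) * a ^ c := by
        rw [← pow_add]; congr 1; omega
    _ = a ^ (p * d) := by rw [key, ← pow_add, hc]

theorem SGSatisfies.of_surjective {i : SGId} (h : SGSatisfies S i) (g : S →ₙ* T)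
    (hg : Function.Surjective g) : SGSatisfies T i := by
  intro f
  choose f' hf' using fun n => hg (f n)
  have := congrArg g (h f')
  simpa only [map_lift, hf'] using this

theorem SGSatisfies.of_injective {i : SGId} (h : SGSatisfies T i) (g : S →ₙ* T)
    (hg : Function.Injective g) : SGSatisfies S i := by
  intro f
  apply hg
  rw [map_lift, map_lift]
  exact h _

end Words

/-- An identity not following from commutativity yields, in any semigroup satisfying it,
an identity between two distinct powers. -/
theorem exists_spow_eq_spow {u v : SGWord} (h : ¬ (letters u).Perm (letters v)) :
    ∃ p d : ℕ, 1 ≤ p ∧ 1 ≤ d ∧ ∀ (S : Type) [Semigroup S], SGSatisfies S (u, v) →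
      ∀ a : S, spow a p = spow a (p + d) := by
  obtain ⟨p, q, hp, hq, hpq, H⟩ : ∃ p q : ℕ, 1 ≤ p ∧ 1 ≤ q ∧ p ≠ q ∧
      ∀ (S : Type) [Semigroup S], SGSatisfies S (u, v) → ∀ a : S, spow a p = spow a q := by
    have hlen : ∀ w : SGWord, 1 ≤ (letters w).length := fun w => by simp [letters]
    have key (i N : ℕ) (S : Type) [Semigroup S] (hS : SGSatisfies S (u, v)) (a : S) :
        spow a ((letters u).length + N * (letters u).count i) =
          spow a ((letters v).length + N * (letters v).count i) := by
      rw [← lift_spow_weight, ← lift_spow_weight]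
      exact hS _
    rw [List.perm_iff_count] at h
    push Not at h
    obtain ⟨i, hi⟩ := h
    by_cases hl : (letters u).length = (letters v).length
    · exact ⟨_, _, (hlen u).trans (Nat.le_add_right _ _), (hlen v).trans (Nat.le_add_right _ _),
        by omega, fun S _ hS a => key i 1 S hS a⟩
    · exact ⟨_, _, (hlen u).trans (Nat.le_add_right _ _), (hlen v).trans (Nat.le_add_right _ _),
        by omega, fun S _ hS a => key i 0 S hS a⟩
  rcases lt_or_gt_of_ne hpq with hlt | hlt
  · exact ⟨p, q - p, hp, by omega, fun S _ hS a => by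
      rw [Nat.add_sub_cancel' hlt.le]; exact H S hS a⟩
  · exact ⟨q, p - q, hq, by omega, fun S _ hS a => by
      rw [Nat.add_sub_cancel' hlt.le]; exact (H S hS a).symm⟩

/-! ### Varieties generated by one semigroup -/

/-- The variety generated by a commutative semigroup. -/
def varietyOf (S : Type) [CommSemigroup S] [Nonempty S] : ComVariety where
  theory := {i | SGSatisfies S i}
  closed := subset_antisymm (fun _ hi => hi ⟨S⟩ fun _ hj => hj) (subset_theoryOfClass_modelsOf _)

theorem generatedBy_varietyOf (M : Type) [CommMonoid M] :
    GeneratedBy M inferInstance (varietyOf M) :=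
  ⟨fun _ hi => hi, fun _ hW => hW⟩

/-- The `V`-equivalence of words. -/
def ComVariety.con (V : ComVariety) : Con SGWord where
  r u v := (u, v) ∈ V.theory
  iseqv := by
    rw [← V.closed]
    exact ⟨fun _ _ _ _ => rfl, fun h S hS f => (h S hS f).symm,
      fun h h' S hS f => (h S hS f).trans (h' S hS f)⟩
  mul' := by
    rw [← V.closed]
    intro a b c d h h' S hS f
    simp only [map_mul]
    exact congrArg₂ (· * ·) (h S hS f) (h' S hS f)

/-- The free semigroup of the variety `V` on countably many generators. -/
abbrev ComVariety.Free (V : ComVariety) : Type := V.con.Quotient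

namespace ComVariety

variable (V : ComVariety)

/-- The class of a word in the free semigroup of `V`. -/
def cls : SGWord →ₙ* V.Free where
  toFun w := (w : V.con.Quotient)
  map_mul' _ _ := rfl

theorem cls_surjective : Function.Surjective V.cls := Quotient.mk_surjective

theorem cls_eq_cls {u v : SGWord} : V.cls u = V.cls v ↔ (u, v) ∈ V.theory := V.con.eq

instance : CommSemigroup V.Free where
  mul_comm a b := by
    obtain ⟨u, rfl⟩ := V.cls_surjective a
    obtain ⟨v, rfl⟩ := V.cls_surjective b
    rw [← map_mul, ← map_mul, cls_eq_cls, ← V.closed]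
    intro S _ f
    simp only [map_mul]
    exact mul_comm _ _

instance : Nonempty V.Free := ⟨V.cls (ltr 0)⟩

theorem lift_of (w : SGWord) : FreeSemigroup.lift FreeSemigroup.of w = w := by
  induction w using FreeSemigroup.recOnMul with
  | ih1 i => simp
  | ih2 u v hu hv => simp only [map_mul, hu, hv]

theorem lift_cls_ltr (w : SGWord) : FreeSemigroup.lift (fun i => V.cls (ltr i)) w = V.cls w := by
  rw [← map_lift V.cls ltr]
  exact congrArg V.cls (lift_of w)

theorem satisfies_free {i : SGId} (hi : i ∈ V.theory) : SGSatisfies V.Free i := by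
  intro f
  choose f' hf' using fun n => V.cls_surjective (f n)
  obtain rfl : (fun n => V.cls (f' n)) = f := funext hf'
  rw [← map_lift, ← map_lift, cls_eq_cls, ← V.closed]
  intro S hS f
  have := fun w => map_lift (FreeSemigroup.lift f) f' w
  simp only [this]
  exact hS i hi _

end ComVariety

/-! ### Local monoids and Rees quotients -/

/-- The local monoid `eS` at an element `e` of a commutative semigroup. -/
def LocalMonoid {S : Type} [CommSemigroup S] (e : S) : Type := {x : S // e * x = x}

namespace LocalMonoid

variable {S : Type} [CommSemigroup S] {e : S}

/-- The commutative monoid structure on `eS` for an idempotent `e`. -/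
abbrev commMonoid (he : e * e = e) : CommMonoid (LocalMonoid e) where
  mul x y := ⟨x.1 * y.1, by rw [← mul_assoc, x.2]⟩
  mul_assoc x y z := Subtype.ext (mul_assoc _ _ _)
  one := ⟨e, he⟩
  one_mul x := Subtype.ext x.2
  mul_one x := Subtype.ext ((mul_comm _ _).trans x.2)
  mul_comm x y := Subtype.ext (mul_comm _ _)

end LocalMonoid

/-- The Rees congruence of the ideal of elements `x` such that `s ^ k * x = x` for some `s`. -/
def powerReesCon (S : Type) [CommSemigroup S] (k : ℕ) : Con S where
  r x y := x = y ∨ (∃ s, spow s k * x = x) ∧ ∃ s, spow s k * y = y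
  iseqv := by
    refine ⟨fun _ => .inl rfl, ?_, ?_⟩
    · rintro x y (rfl | ⟨h, h'⟩)
      exacts [.inl rfl, .inr ⟨h', h⟩]
    · rintro x y z (rfl | ⟨h, h'⟩) (rfl | ⟨h₁, h₂⟩)
      exacts [.inl rfl, .inr ⟨h₁, h₂⟩, .inr ⟨h, h'⟩, .inr ⟨h, h₂⟩]
  mul' := by
    have key : ∀ x y : S, (∃ s, spow s k * x = x) → ∃ s, spow s k * (x * y) = x * y :=
      fun x y ⟨s, hs⟩ => ⟨s, by rw [← mul_assoc, hs]⟩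
    have key' : ∀ x y : S, (∃ s, spow s k * y = y) → ∃ s, spow s k * (x * y) = x * y :=
      fun x y h => by rw [mul_comm]; exact key y x h
    rintro a b c d (rfl | ⟨h, h'⟩) (rfl | ⟨h₁, h₂⟩)
    exacts [.inl rfl, .inr ⟨key' _ _ h₁, key' _ _ h₂⟩, .inr ⟨key _ _ h, key _ _ h'⟩,
      .inr ⟨key _ _ h, key _ _ h'⟩]

instance (S : Type) [CommSemigroup S] [Nonempty S] (k : ℕ) :
    Nonempty (powerReesCon S k).Quotient :=
  Nonempty.map (fun x : S => (x : (powerReesCon S k).Quotient)) inferInstance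

theorem isNilVariety_powerRees (S : Type) [CommSemigroup S] [Nonempty S] {k : ℕ} (hk : 1 ≤ k)
    (h : ∀ a : S, spow a k * spow a k = spow a k) :
    IsNilVariety (varietyOf (powerReesCon S k).Quotient) := by
  let π : S →ₙ* (powerReesCon S k).Quotient := ⟨fun x => x, fun _ _ => rfl⟩
  have hπ : Function.Surjective π := Quotient.mk_surjective
  intro T hT
  have habs : ∀ a b : T.carrier, spow a k * b = spow a k := by
    have hid : ((spow (ltr 0) k * ltr 1, spow (ltr 0) k) : SGId) ∈
        (varietyOf (powerReesCon S k).Quotient).theory := by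
      intro f
      rw [map_mul, map_spow]
      simp only [ltr, FreeSemigroup.lift_of]
      obtain ⟨a, ha⟩ := hπ (f 0)
      obtain ⟨b, hb⟩ := hπ (f 1)
      rw [← ha, ← hb, ← map_spow, ← map_mul]
      exact (powerReesCon S k).eq.2 (.inr ⟨⟨a, by rw [← mul_assoc, h]⟩, ⟨a, h a⟩⟩)
    intro a b
    have := hT _ hid fun n => if n = 0 then a else b
    simpa [map_spow, ltr] using this
  obtain ⟨c⟩ := T.instNonempty
  refine ⟨spow c k, fun a => ⟨habs c a, (mul_comm _ _).trans (habs c a)⟩, fun a => ⟨k, hk, ?_⟩⟩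
  rw [← habs a (spow c k), mul_comm, habs]

/-- In the free semigroup of `V`, an identity of the local monoid at `x ^ k` holds after
multiplication by any `k`-th power. -/
theorem spow_mul_cls_eq_of_localMonoid (V : ComVariety) {k : ℕ}
    (he : V.cls (spow (ltr 0) k) * V.cls (spow (ltr 0) k) = V.cls (spow (ltr 0) k)) {u v : SGWord}
    (h : @SGSatisfies _ (LocalMonoid.commMonoid he).toSemigroup (u, v)) (s : V.Free) :
    spow s k * V.cls u = spow s k * V.cls v := by
  let := LocalMonoid.commMonoid he
  let val : LocalMonoid (V.cls (spow (ltr 0) k)) →ₙ* V.Free := ⟨fun x => x.1, fun _ _ => rfl⟩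
  let sh : SGWord → SGWord := FreeSemigroup.lift fun i => ltr (i + 1)
  let g : ℕ → LocalMonoid (V.cls (spow (ltr 0) k)) :=
    fun i => ⟨V.cls (spow (ltr 0) k) * V.cls (ltr (i + 1)), by rw [← mul_assoc, he]⟩
  have hev : ∀ w, val (FreeSemigroup.lift g w) = V.cls (spow (ltr 0) k * sh w) := by
    intro w
    rw [map_lift, map_mul]
    refine (lift_mul_left_eq he (fun i => V.cls (ltr (i + 1))) w).trans ?_
    rw [map_lift V.cls]
  have h1 := congrArg val (h g)
  rw [hev, hev, V.cls_eq_cls] at h1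
  have h2 := V.satisfies_free h1 fun i => Nat.casesOn i s fun j => V.cls (ltr j)
  have h3 : ∀ w, FreeSemigroup.lift (fun i => Nat.casesOn i s fun j => V.cls (ltr j))
      (spow (ltr 0) k * sh w) = spow s k * V.cls w := by
    intro w
    rw [map_mul, map_spow, map_lift]
    simp only [ltr, FreeSemigroup.lift_of]
    exact congrArg _ (V.lift_cls_ltr w)
  rwa [h3, h3] at h2

/-- **Lemma.** If `V` is a commutative semigroup variety with `V ≠ COM`, then
`V = K ∨ N` where `K` is a variety generated by a monoid and `N` is a nil-variety. -/
theorem decomposition_monoid_join_nil (V : ComVariety) (hV : V ≠ COMvar) :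
    ∃ K N : ComVariety,
      (∃ (M : Type) (inst : Monoid M), GeneratedBy M inst.toSemigroup K) ∧
      IsNilVariety N ∧ V = K ⊔ N := by
  obtain ⟨k, hk, hidem⟩ : ∃ k, 1 ≤ k ∧ ∀ a : V.Free, spow a k * spow a k = spow a k := by
    obtain ⟨⟨u, v⟩, huv, hperm⟩ : ∃ i ∈ V.theory, ¬ (letters i.1).Perm (letters i.2) := by
      by_contra! H
      apply hV
      apply ComVariety.ext'
      apply subset_antisymm
      · exact fun i hi S _ f => lift_eq_of_perm f (H i hi)
      · rw [← V.closed]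
        refine fun i hi S _ => hi S ?_
        rintro j rfl f
        simp only [commId, map_mul]
        exact mul_comm _ _
    obtain ⟨p, d, hp, hd, H⟩ := exists_spow_eq_spow hperm
    exact ⟨p * d, Nat.mul_pos hp hd,
      fun a => spow_mul_self_of_eq hp hd (H _ (V.satisfies_free huv) a)⟩
  have he : V.cls (spow (ltr 0) k) * V.cls (spow (ltr 0) k) = V.cls (spow (ltr 0) k) := by
    rw [map_spow, hidem]
  let := LocalMonoid.commMonoid he
  let Q := (powerReesCon V.Free k).Quotient
  refine ⟨varietyOf (LocalMonoid (V.cls (spow (ltr 0) k))), varietyOf Q,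
    ⟨_, inferInstance, generatedBy_varietyOf _⟩, isNilVariety_powerRees _ hk hidem,
    le_antisymm ?_ (sup_le ?_ ?_)⟩
  · rintro ⟨u, v⟩ hi
    have hK := spow_mul_cls_eq_of_localMonoid V he
      ((le_sup_left : varietyOf (LocalMonoid (V.cls (spow (ltr 0) k))) ≤ _ ⊔ varietyOf Q) hi)
    have hN : SGSatisfies Q (u, v) :=
      (le_sup_right : _ ≤ varietyOf (LocalMonoid (V.cls (spow (ltr 0) k))) ⊔ varietyOf Q) hi
    let π : V.Free →ₙ* Q := ⟨fun x => x, fun _ _ => rfl⟩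
    have hπ : π (V.cls u) = π (V.cls v) := by
      rw [← V.lift_cls_ltr u, ← V.lift_cls_ltr v, map_lift, map_lift]
      exact hN _
    rw [← V.cls_eq_cls]
    rcases (powerReesCon V.Free k).eq.1 hπ with h | ⟨⟨s, hs⟩, ⟨t, ht⟩⟩
    · exact h
    · calc V.cls u = spow s k * V.cls v := by rw [← hK, hs]
        _ = spow t k * (spow s k * V.cls v) := by rw [mul_left_comm, ht]
        _ = V.cls v := by rw [← hK s, hs, hK, ht]
  · intro i hi
    exact (V.satisfies_free hi).of_injective
      (⟨fun x => x.1, fun _ _ => rfl⟩ : LocalMonoid (V.cls (spow (ltr 0) k)) →ₙ* V.Free)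
      Subtype.val_injective
  · intro i hi
    exact (V.satisfies_free hi).of_surjective
      (⟨fun x => x, fun _ _ => rfl⟩ : V.Free →ₙ* Q) Quotient.mk_surjective
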